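/- There exist n₀ ∈ ℕ and constants c, c′ > 0, independent of the scaling parameter a, with the following property. For every a > 0, if f is a centered continuous stationary Gaussian process on ℝ whose spectral measure μ is supported on [−a/2, a/2] \ (−a/4, a/4), then for every integer n ≥ n₀ there exist a number σ ∈ [0, √(μ(ℝ))] and nonnegative reals β₀, …, β_n with Σ_{k=0}^n β_k = 1 such that: (i) E[(Σ_{k=0}^n β_k f(k/a))²] ≤ e^{−6cn} σ²; and (ii) for every deterministic function φ : ℝ → ℝ, the probability of the event that f(k/a) + φ(k/a) ≥ 0 for every k ∈ {0, …, n} with β_k > 0 and simultaneously Σ_{k=0}^n β_k (f(k/a) + φ(k/a)) ≤ e^{−cn} σ, is at most e^{−c′n²}. -/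

import Mathlib

open MeasureTheory ProbabilityTheory Real
open scoped NNReal

lemma gaussianReal_Icc_le {v : ℝ≥0} (hv : v ≠ 0) (u l : ℝ) :
    gaussianReal 0 v (Set.Icc u (u + l)) ≤ ENNReal.ofReal (l / √v) := by
  have hv' : 0 < (v : ℝ) := by positivity
  have hs : 0 < √(v : ℝ) := Real.sqrt_pos.2 hv'
  have hpdf : ∀ x, gaussianPDF 0 v x ≤ ENNReal.ofReal (1 / √v) := by
    intro x
    refine ENNReal.ofReal_le_ofReal ?_
    rw [gaussianPDFReal]
    have h1 : rexp (-(x - 0) ^ 2 / (2 * v)) ≤ 1 := by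
      rw [Real.exp_le_one_iff]
      exact div_nonpos_of_nonpos_of_nonneg (by nlinarith [sq_nonneg (x - 0)]) (by positivity)
    have h2 : (√(2 * π * v))⁻¹ ≤ 1 / √v := by
      rw [one_div]
      refine inv_anti₀ hs (Real.sqrt_le_sqrt ?_)
      nlinarith [Real.pi_gt_three]
    calc _ ≤ (√(2 * π * v))⁻¹ * 1 := by gcongr
      _ ≤ _ := by simpa using h2
  rw [gaussianReal_apply _ hv]
  calc ∫⁻ x in Set.Icc u (u + l), gaussianPDF 0 v x
      ≤ ∫⁻ _ in Set.Icc u (u + l), ENNReal.ofReal (1 / √v) := lintegral_mono hpdf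
    _ = ENNReal.ofReal (l / √v) := by
      rw [setLIntegral_const, Real.volume_Icc, ← ENNReal.ofReal_mul (by positivity)]
      congr 1; ring

lemma indep_add_Icc_le {Ω : Type*} [MeasurableSpace Ω] {P : Measure Ω} [IsProbabilityMeasure P]
    {E : Type*} [MeasurableSpace E] {U : Ω → E} {Y : Ω → ℝ} (hU : Measurable U)
    (hY : Measurable Y) (hind : IndepFun U Y P) {v : ℝ≥0} (hv : v ≠ 0)
    (hlaw : P.map Y = gaussianReal 0 v) {A : Set E} (hA : MeasurableSet A) {g : E → ℝ}
    (hg : Measurable g) (u l : ℝ) :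
    P {ω | U ω ∈ A ∧ Y ω + g (U ω) ∈ Set.Icc u (u + l)} ≤
      P {ω | U ω ∈ A} * ENNReal.ofReal (l / √v) := by
  have hS : MeasurableSet {p : E × ℝ | p.1 ∈ A ∧ p.2 + g p.1 ∈ Set.Icc u (u + l)} :=
    (measurable_fst hA).inter
      ((measurable_snd.add (hg.comp measurable_fst)) measurableSet_Icc)
  have h1 : P {ω | U ω ∈ A ∧ Y ω + g (U ω) ∈ Set.Icc u (u + l)} =
      P.map (fun ω => (U ω, Y ω)) {p : E × ℝ | p.1 ∈ A ∧ p.2 + g p.1 ∈ Set.Icc u (u + l)} := by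
    rw [Measure.map_apply (hU.prodMk hY) hS]; rfl
  have : IsProbabilityMeasure (P.map Y) := Measure.isProbabilityMeasure_map hY.aemeasurable
  rw [h1, (indepFun_iff_map_prod_eq_prod_map_map hU.aemeasurable hY.aemeasurable).1 hind,
    Measure.prod_apply hS]
  calc _ ≤ ∫⁻ x, A.indicator (fun _ => ENNReal.ofReal (l / √v)) x ∂(P.map U) := by
        refine lintegral_mono fun x => ?_
        by_cases hx : x ∈ A
        · simp only [hx, Set.indicator_of_mem]
          have : Prod.mk x ⁻¹' {p : E × ℝ | p.1 ∈ A ∧ p.2 + g p.1 ∈ Set.Icc u (u + l)} =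
              Set.Icc (u - g x) (u - g x + l) := by
            ext y
            simp only [Set.mem_preimage, Set.mem_ofPred_eq, hx, true_and, Set.mem_Icc]
            constructor <;> rintro ⟨h, h'⟩ <;> constructor <;> linarith
          rw [this, hlaw]
          exact gaussianReal_Icc_le hv _ _
        · simp [hx]
    _ = _ := by
        rw [lintegral_indicator_const hA, Measure.map_apply hU hA, mul_comm]; rfl

/-- Every finite linear combination of the terms of `X` is a centered Gaussian. -/
def IsCenteredGaussianSeq {Ω : Type*} [MeasurableSpace Ω] (P : Measure Ω) (X : ℕ → Ω → ℝ) : Prop :=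
  ∀ (n : ℕ) (b : Fin n → ℝ), ∃ v : ℝ≥0,
    P.map (fun ω => ∑ i, b i * X i ω) = gaussianReal 0 v

section GaussianSeq

variable {Ω : Type*} [MeasurableSpace Ω] {P : Measure Ω} [IsProbabilityMeasure P]
  {X : ℕ → Ω → ℝ}

omit [IsProbabilityMeasure P] in
lemma IsCenteredGaussianSeq.hasGaussianLaw (hG : IsCenteredGaussianSeq P X)
    (hX : ∀ i, Measurable (X i)) (n : ℕ) :
    HasGaussianLaw (fun ω (i : Fin n) => X i ω) P := by
  constructor
  refine isGaussian_of_map_eq_gaussianReal fun L => ?_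
  obtain ⟨v, hv⟩ := hG n (fun i => L (Pi.single i 1))
  refine ⟨0, v, ?_⟩
  rw [Measure.map_map L.continuous.measurable (measurable_pi_lambda _ fun i => hX i), ← hv]
  congr 1
  ext ω
  simp only [Function.comp_apply]
  conv_lhs => rw [pi_eq_sum_univ' (fun i : Fin n => X i ω)]
  simp [map_sum, mul_comm, Pi.single]

omit [IsProbabilityMeasure P] in
lemma IsCenteredGaussianSeq.sum_range (hG : IsCenteredGaussianSeq P X) (n : ℕ) (b : ℕ → ℝ) :
    ∃ v : ℝ≥0, P.map (fun ω => ∑ i ∈ Finset.range n, b i * X i ω) = gaussianReal 0 v := by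
  obtain ⟨v, hv⟩ := hG n (fun i => b i)
  refine ⟨v, ?_⟩
  rw [← hv]
  simp only [Finset.sum_range]

omit [IsProbabilityMeasure P] in
lemma IsCenteredGaussianSeq.memLp (hG : IsCenteredGaussianSeq P X)
    (hX : ∀ i, Measurable (X i)) (n : ℕ) : MemLp (X n) 2 P :=
  ((hG.hasGaussianLaw hX (n + 1)).eval (Fin.last n)).memLp_two

omit [IsProbabilityMeasure P] in
lemma exists_proj_of_memLp (hX : ∀ i, MemLp (X i) 2 P) (n : ℕ) :
    ∃ c : ℕ → ℝ, ∀ i < n,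
      ∫ ω, (X n ω - ∑ j ∈ Finset.range n, c j * X j ω) * X i ω ∂P = 0 := by
  let v : ℕ → Lp ℝ 2 P := fun i => (hX i).toLp
  let K := Submodule.span ℝ (Set.range fun i : Fin n => v i)
  have hfin : FiniteDimensional ℝ K := FiniteDimensional.span_of_finite ℝ (Set.finite_range _)
  obtain ⟨c, hc⟩ := (Submodule.mem_span_range_iff_exists_fun ℝ).1
    (K.starProjection_apply_mem (v n))
  refine ⟨fun i => if h : i < n then c ⟨i, h⟩ else 0, fun i hi => ?_⟩
  have h := K.starProjection_inner_eq_zero (v n) (v i)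
    (Submodule.subset_span ⟨⟨i, hi⟩, rfl⟩)
  rw [← hc, L2.inner_def] at h
  refine Eq.trans (integral_congr_ae ?_) h
  have h1 : ∀ᵐ ω ∂P, ∀ i, (v i : Ω → ℝ) ω = X i ω := ae_all_iff.2 fun i => (hX i).coeFn_toLp
  have h2 := Lp.coeFn_sub (v n) (∑ i : Fin n, c i • v i)
  have h3 := Lp.coeFn_finsetSum Finset.univ (fun i : Fin n => c i • v i)
  have h4 : ∀ᵐ ω ∂P, ∀ i : Fin n, (c i • v i : Lp ℝ 2 P) ω = c i * v i ω :=
    ae_all_iff.2 fun i => Lp.coeFn_smul (c i) (v i)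
  filter_upwards [h1, h2, h3, h4] with ω h1 h2 h3 h4
  simp only [h2, h1, Pi.sub_apply, h3, Finset.sum_apply, h4, Finset.sum_range]
  simp [mul_comm]

omit [IsProbabilityMeasure P] in
lemma integral_sq_le_of_orthogonal (hX : ∀ i, MemLp (X i) 2 P) (n : ℕ) {c : ℕ → ℝ}
    (hc : ∀ i < n, ∫ ω, (X n ω - ∑ j ∈ Finset.range n, c j * X j ω) * X i ω ∂P = 0)
    (d : ℕ → ℝ) :
    ∫ ω, (X n ω - ∑ j ∈ Finset.range n, c j * X j ω) ^ 2 ∂P ≤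
      ∫ ω, (X n ω - ∑ j ∈ Finset.range n, d j * X j ω) ^ 2 ∂P := by
  have hL : ∀ e : ℕ → ℝ, MemLp (fun ω => X n ω - ∑ j ∈ Finset.range n, e j * X j ω) 2 P :=
    fun e => (hX n).sub (memLp_finsetSum _ fun j _ => (hX j).const_mul _)
  have hprod : ∀ i, Integrable (fun ω => (2 * (c i - d i)) *
      ((X n ω - ∑ j ∈ Finset.range n, c j * X j ω) * X i ω)) P :=
    fun i => ((hL c).integrable_mul (hX i)).const_mul _
  have hcross : ∫ ω, ∑ i ∈ Finset.range n, (2 * (c i - d i)) *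
      ((X n ω - ∑ j ∈ Finset.range n, c j * X j ω) * X i ω) ∂P = 0 := by
    rw [integral_finsetSum _ fun i _ => hprod i]
    refine Finset.sum_eq_zero fun i hi => ?_
    rw [integral_const_mul, hc i (Finset.mem_range.1 hi), mul_zero]
  have hint : Integrable (fun ω => ∑ i ∈ Finset.range n, (2 * (c i - d i)) *
      ((X n ω - ∑ j ∈ Finset.range n, c j * X j ω) * X i ω)) P :=
    integrable_finsetSum _ fun i _ => hprod i
  calc _ = ∫ ω, (X n ω - ∑ j ∈ Finset.range n, c j * X j ω) ^ 2 + ∑ i ∈ Finset.range n,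
        (2 * (c i - d i)) * ((X n ω - ∑ j ∈ Finset.range n, c j * X j ω) * X i ω) ∂P := by
        rw [integral_add (hL c).integrable_sq hint, hcross, add_zero]
    _ ≤ _ := by
      refine integral_mono ((hL c).integrable_sq.add hint) (hL d).integrable_sq fun ω => ?_
      have h1 : ∑ i ∈ Finset.range n, (2 * (c i - d i)) *
          ((X n ω - ∑ j ∈ Finset.range n, c j * X j ω) * X i ω) =
          2 * (X n ω - ∑ j ∈ Finset.range n, c j * X j ω) *
            (∑ j ∈ Finset.range n, c j * X j ω - ∑ j ∈ Finset.range n, d j * X j ω) := by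
        rw [← Finset.sum_sub_distrib, Finset.mul_sum]
        exact Finset.sum_congr rfl fun i _ => by ring
      simp only [h1]
      nlinarith [sq_nonneg (∑ j ∈ Finset.range n, c j * X j ω -
        ∑ j ∈ Finset.range n, d j * X j ω)]

/-- If each `X j` stays at `L²`-distance at least `√(D j)` from the linear span of its
predecessors, the first `n` terms lie in prescribed intervals with small probability. -/
lemma IsCenteredGaussianSeq.measure_forall_mem_Icc_le (hG : IsCenteredGaussianSeq P X)
    (hX : ∀ i, Measurable (X i)) (D u l : ℕ → ℝ) (n : ℕ) (hD : ∀ j < n, 0 < D j)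
    (hl : ∀ j < n, 0 ≤ l j)
    (hDX : ∀ j < n, ∀ c : ℕ → ℝ,
      D j ≤ ∫ ω, (X j ω - ∑ i ∈ Finset.range j, c i * X i ω) ^ 2 ∂P) :
    P {ω | ∀ j < n, X j ω ∈ Set.Icc (u j) (u j + l j)} ≤
      ENNReal.ofReal (∏ j ∈ Finset.range n, l j / √(D j)) := by
  induction n with
  | zero => simp
  | succ n ih =>
    have ih := ih (fun j hj => hD j (by lia)) (fun j hj => hl j (by lia))
      (fun j hj => hDX j (by lia))
    have hL := fun i => hG.memLp hX i
    obtain ⟨c, hc⟩ := exists_proj_of_memLp hL n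
    have hDn := hDX n (by lia) c
    let U : Ω → Fin n → ℝ := fun ω i => X i ω
    let Y : Ω → ℝ := fun ω => X n ω - ∑ j ∈ Finset.range n, c j * X j ω
    have hU : Measurable U := measurable_pi_lambda _ fun i => hX i
    have hY : Measurable Y := by fun_prop
    have hYL : MemLp Y 2 P := (hL n).sub (memLp_finsetSum _ fun j _ => (hL j).const_mul _)
    have hlin : ∀ b : ℕ → ℝ, ∫ ω, ∑ i ∈ Finset.range (n+1), b i * X i ω ∂P = 0 := by
      intro b
      obtain ⟨v, hv⟩ := hG.sum_range (n + 1) b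
      have := integral_map (μ := P) (φ := fun ω => ∑ i ∈ Finset.range (n+1), b i * X i ω)
        (f := fun x => x) (by fun_prop) (by fun_prop)
      rw [← this, hv, integral_id_gaussianReal]
    have hYsum : ∀ ω, Y ω = ∑ i ∈ Finset.range (n+1), (if i < n then - c i else 1) * X i ω := by
      intro ω
      rw [Finset.sum_range_succ]
      have : ∑ i ∈ Finset.range n, (if i < n then - c i else 1) * X i ω =
          - ∑ i ∈ Finset.range n, c i * X i ω := by
        rw [← Finset.sum_neg_distrib]
        refine Finset.sum_congr rfl fun i hi => ?_
        rw [if_pos (Finset.mem_range.1 hi)]; ring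
      simp only [this, lt_irrefl, if_false, Y]; ring
    have hYmean : ∫ ω, Y ω ∂P = 0 := by simp_rw [hYsum]; exact hlin _
    obtain ⟨v, hv⟩ : ∃ v : ℝ≥0, P.map Y = gaussianReal 0 v := by
      obtain ⟨v, hv⟩ := hG.sum_range (n + 1) (fun i => if i < n then - c i else 1)
      exact ⟨v, by rw [← hv]; congr 1; ext ω; exact hYsum ω⟩
    have hvar : (v : ℝ) = ∫ ω, Y ω ^ 2 ∂P := by
      rw [← variance_of_integral_eq_zero hY.aemeasurable hYmean,
        ← variance_id_gaussianReal (μ := 0) (v := v), ← hv, variance_map (by fun_prop) (by fun_prop)]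
      rfl
    have hDv : D n ≤ v := by rw [hvar]; exact hDn
    have hDn0 := hD n (by lia)
    have hv0 : v ≠ 0 := by
      rintro rfl
      simp at hDv; linarith
    have hind : IndepFun U Y P := by
      have hjoint : HasGaussianLaw (fun ω => (fun i : Fin n => X i ω, fun _ : Unit => Y ω)) P := by
        let T : (Fin (n + 1) → ℝ) →L[ℝ] (Fin n → ℝ) × (Unit → ℝ) :=
          (ContinuousLinearMap.pi fun i : Fin n => ContinuousLinearMap.proj i.castSucc).prod
            (ContinuousLinearMap.pi fun _ : Unit => ContinuousLinearMap.proj (Fin.last n) -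
              ∑ i : Fin n, c i • ContinuousLinearMap.proj i.castSucc)
        have hT : (fun ω => (fun i : Fin n => X i ω, fun _ : Unit => Y ω)) =
            fun ω => T (fun i : Fin (n + 1) => X i ω) := by
          ext ω i
          · simp [T]
          · simp [T, Y, Finset.sum_range]
        rw [hT]
        exact (hG.hasGaussianLaw hX (n + 1)).map_fun T
      have := hjoint.indepFun_of_covariance_eval (fun i j => by
        rw [covariance_eq_sub (hL i) hYL, hYmean, mul_zero, sub_zero, ← hc i i.2]
        refine integral_congr_ae (.of_forall fun ω => ?_)
        simp [Y, mul_comm])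
      exact this.comp (φ := id) (ψ := fun z : Unit → ℝ => z ()) measurable_id (by fun_prop)
    have hA : MeasurableSet {z : Fin n → ℝ | ∀ j : Fin n, z j ∈ Set.Icc (u j) (u j + l j)} := by
      simp only [Set.ofPred_forall]
      exact MeasurableSet.iInter fun j => (measurable_pi_apply j) measurableSet_Icc
    have key := indep_add_Icc_le hU hY hind hv0 hv hA (g := fun z => ∑ j : Fin n, c j * z j)
      (by fun_prop) (u n) (l n)
    have e1 : {ω | ∀ j < n + 1, X j ω ∈ Set.Icc (u j) (u j + l j)} =
        {ω | U ω ∈ {z : Fin n → ℝ | ∀ j : Fin n, z j ∈ Set.Icc (u j) (u j + l j)} ∧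
          Y ω + (fun z : Fin n → ℝ => ∑ j : Fin n, c j * z j) (U ω) ∈
            Set.Icc (u n) (u n + l n)} := by
      ext ω
      have : Y ω + ∑ j : Fin n, c j * U ω j = X n ω := by
        simp [Y, U, Finset.sum_range]
      simp only [Set.mem_ofPred_eq, this, Nat.forall_lt_succ_right, Fin.forall_iff, U]
    have e2 : {ω | U ω ∈ {z : Fin n → ℝ | ∀ j : Fin n, z j ∈ Set.Icc (u j) (u j + l j)}} =
        {ω | ∀ j < n, X j ω ∈ Set.Icc (u j) (u j + l j)} := by
      ext ω
      simp only [Set.mem_ofPred_eq, Fin.forall_iff, U]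
    rw [e1]
    refine key.trans ?_
    rw [e2, Finset.prod_range_succ, ENNReal.ofReal_mul
      (Finset.prod_nonneg fun j hj =>
        div_nonneg (hl j (by have := Finset.mem_range.1 hj; lia)) (Real.sqrt_nonneg _))]
    gcongr
    exact hl n (by lia)

end GaussianSeq

open Polynomial in
/-- Moving the roots of a real monic polynomial into the closed left half-plane decreases its
modulus on the left half of the unit circle and makes all its coefficients nonnegative. -/
lemma Polynomial.Monic.exists_nonneg_coeff_norm_le {p : ℝ[X]} (hp : p.Monic) :
    ∃ q : ℝ[X], q.Monic ∧ q.natDegree = p.natDegree ∧ (∀ k, 0 ≤ q.coeff k) ∧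
      ∀ z : ℂ, ‖z‖ = 1 → z.re ≤ 0 → ‖aeval z q‖ ≤ ‖aeval z p‖ := by
  induction hd : p.natDegree using Nat.strong_induction_on generalizing p with
  | _ d ih =>
  subst hd
  by_cases hu : p.natDegree = 0
  · refine ⟨1, monic_one, by simp [hu], fun k => ?_, fun z _ _ => ?_⟩
    · rw [coeff_one]; split_ifs <;> norm_num
    · rw [hp.natDegree_eq_zero.1 hu]
  obtain ⟨g, hgm, hgi, h, rfl⟩ := exists_monic_irreducible_factor p
    (fun h => hu (natDegree_eq_zero_of_isUnit h))
  have hhm : h.Monic := hgm.of_mul_monic_left hp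
  have hgd : 0 < g.natDegree := hgi.natDegree_pos
  obtain ⟨q, hqm, hqd, hq0, hqn⟩ := ih h.natDegree (by rw [hgm.natDegree_mul hhm]; lia) hhm rfl
  suffices H : ∃ r : ℝ[X], r.Monic ∧ r.natDegree = g.natDegree ∧ (∀ k, 0 ≤ r.coeff k) ∧
      ∀ z : ℂ, ‖z‖ = 1 → z.re ≤ 0 → ‖aeval z r‖ ≤ ‖aeval z g‖ by
    obtain ⟨r, hrm, hrd, hr0, hrn⟩ := H
    refine ⟨r * q, hrm.mul hqm, ?_, fun k => ?_, fun z hz hz' => ?_⟩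
    · rw [hrm.natDegree_mul hqm, hgm.natDegree_mul hhm, hrd, hqd]
    · rw [coeff_mul]
      exact Finset.sum_nonneg fun x _ => mul_nonneg (hr0 _) (hq0 _)
    · rw [map_mul, map_mul, norm_mul, norm_mul]
      exact mul_le_mul (hrn z hz hz') (hqn z hz hz') (norm_nonneg _) (norm_nonneg _)
  have hg2 : g.natDegree ≤ 2 := natDegree_le_of_degree_le hgi.degree_le_two
  by_cases hg0 : ∀ k, 0 ≤ g.coeff k
  · exact ⟨g, hgm, rfl, hg0, fun z _ _ => le_rfl⟩
  have h12 : g.natDegree = 1 ∨ g.natDegree = 2 := by lia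
  rcases h12 with h1 | h2
  · have hg : g = X + C (g.coeff 0) := by
      conv_lhs => rw [hgm.as_sum, h1]
      simp
    have hneg : g.coeff 0 < 0 := by
      by_contra! hc
      refine hg0 fun k => ?_
      rw [hg]
      simp only [coeff_add, coeff_X, coeff_C]
      split_ifs <;> linarith
    refine ⟨X, monic_X, by simp [h1], fun k => ?_, fun z hz hz' => ?_⟩
    · rw [coeff_X]; split_ifs <;> norm_num
    · rw [hg]
      set b := g.coeff 0
      simp only [aeval_X, map_add, aeval_C, Complex.coe_algebraMap]
      rw [← sq_le_sq₀ (norm_nonneg _) (norm_nonneg _), Complex.sq_norm, Complex.sq_norm,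
        Complex.normSq_apply, Complex.normSq_apply]
      simp
      nlinarith
  · have hg : g = X ^ 2 + (C (g.coeff 0) + C (g.coeff 1) * X) := by
      conv_lhs => rw [hgm.as_sum, h2]
      simp [Finset.sum_range_succ]
    have hnoroot : ∀ x : ℝ, x ^ 2 + (g.coeff 0 + g.coeff 1 * x) ≠ 0 := by
      intro x hx
      refine hgi.not_isRoot_of_natDegree_ne_one (by lia) (x := x) ?_
      rw [hg]; simpa using hx
    set b := g.coeff 1
    set c := g.coeff 0
    have hdisc : b ^ 2 < 4 * c := by
      by_contra! hc
      refine hnoroot ((-b + √(b ^ 2 - 4 * c)) / 2) ?_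
      have := Real.sq_sqrt (sub_nonneg.2 hc)
      linear_combination this / 4
    have hneg : b < 0 := by
      by_contra! hc
      refine hg0 fun k => ?_
      rw [hg]
      simp only [coeff_add, coeff_X_pow, coeff_C, coeff_C_mul, coeff_X]
      split_ifs <;> nlinarith [sq_nonneg b]
    have hv : 0 < c - b ^ 2 / 4 := by linarith
    refine ⟨X ^ 2 + C (c - b ^ 2 / 4), monic_X_pow_add_C _ (by norm_num), ?_, fun k => ?_,
      fun z hz hz' => ?_⟩
    · rw [natDegree_X_pow_add_C, h2]
    · simp only [coeff_add, coeff_X_pow, coeff_C]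
      split_ifs <;> linarith
    · rw [hg]
      set v := √(c - b ^ 2 / 4) with hvdef
      have hvv : v ^ 2 = c - b ^ 2 / 4 := Real.sq_sqrt hv.le
      have e1 : aeval z (X ^ 2 + C (c - b ^ 2 / 4)) =
          (z - v * Complex.I) * (z + v * Complex.I) := by
        rw [← hvv]
        simp
        linear_combination ((v : ℂ) ^ 2) * Complex.I_sq
      have e2 : aeval z (X ^ 2 + (C c + C b * X)) =
          (z + (b / 2 : ℝ) - v * Complex.I) * (z + (b / 2 : ℝ) + v * Complex.I) := by
        have : c = v ^ 2 + b ^ 2 / 4 := by linarith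
        rw [this]
        simp
        linear_combination ((v : ℂ) ^ 2) * Complex.I_sq
      rw [e1, e2, norm_mul, norm_mul]
      refine mul_le_mul ?_ ?_ (norm_nonneg _) (norm_nonneg _) <;>
      · rw [← sq_le_sq₀ (norm_nonneg _) (norm_nonneg _), Complex.sq_norm, Complex.sq_norm,
          Complex.normSq_apply, Complex.normSq_apply]
        simp
        nlinarith

lemma normSq_add_one_le {z : ℂ} (hz : ‖z‖ = 1) (hz' : z.re ≤ 0) : ‖z + 1‖ ^ 2 ≤ 2 := by
  have h : z.re * z.re + z.im * z.im = 1 := by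
    rw [← Complex.normSq_apply, ← Complex.sq_norm, hz]; norm_num
  rw [Complex.sq_norm, Complex.normSq_apply]
  simp
  nlinarith

/-- A monic quadratic whose supremum on the left half of the unit circle is less than `1`. -/
lemma normSq_quadratic_le {z : ℂ} (hz : ‖z‖ = 1) (hz' : z.re ≤ 0) :
    ‖z ^ 2 + (2 / 3 * z + 1 / 2)‖ ^ 2 ≤ 25 / 36 := by
  have h : z.re * z.re + z.im * z.im = 1 := by
    rw [← Complex.normSq_apply, ← Complex.sq_norm, hz]; norm_num
  have h1 : -1 ≤ z.re := by nlinarith [mul_self_nonneg z.im]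
  rw [Complex.sq_norm, Complex.normSq_apply]
  have e1 : (z ^ 2 + (2 / 3 * z + 1 / 2)).re = z.re ^ 2 - z.im ^ 2 + 2 / 3 * z.re + 1 / 2 := by
    simp [pow_two]
    ring
  have e2 : (z ^ 2 + (2 / 3 * z + 1 / 2)).im = 2 * z.re * z.im + 2 / 3 * z.im := by
    simp [pow_two]
    ring
  rw [e1, e2]
  have h2 : z.im ^ 2 = 1 - z.re ^ 2 := by linarith
  have : (z.re ^ 2 - z.im ^ 2 + 2 / 3 * z.re + 1 / 2) * (z.re ^ 2 - z.im ^ 2 + 2 / 3 * z.re + 1 / 2)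
      + (2 * z.re * z.im + 2 / 3 * z.im) * (2 * z.re * z.im + 2 / 3 * z.im) =
      25 / 36 + 2 * z.re * (z.re + 1) := by
    have : (2 * z.re * z.im + 2 / 3 * z.im) * (2 * z.re * z.im + 2 / 3 * z.im) =
      (2 * z.re + 2 / 3) ^ 2 * z.im ^ 2 := by ring
    rw [this, h2]; ring
  rw [this]
  nlinarith

open Polynomial in
lemma natDegree_X_pow_add_of_degree_lt {n : ℕ} {r : ℝ[X]} (hr : r.degree < n) :
    (X ^ n + r).natDegree = n := by
  rw [natDegree_add_eq_left_of_degree_lt (by rwa [degree_X_pow]), natDegree_X_pow]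

/-- The squared `L²(μ)`-norm of a real polynomial evaluated at `exp (i θ)`. -/
noncomputable def polyEnergy (μ : Measure ℝ) (θ : ℝ → ℝ) (p : Polynomial ℝ) : ℝ :=
  ∫ y, ‖Polynomial.aeval (Complex.exp (θ y * Complex.I)) p‖ ^ 2 ∂μ

section PolyEnergy

open Polynomial

variable {μ : Measure ℝ} [IsFiniteMeasure μ] {θ : ℝ → ℝ}

lemma integrable_norm_aeval_sq (hθ : Measurable θ) (p : ℝ[X]) :
    Integrable (fun y => ‖aeval (Complex.exp (θ y * Complex.I)) p‖ ^ 2) μ := by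
  have hc : Continuous fun w : ℂ => ‖aeval w p‖ ^ 2 := by fun_prop
  obtain ⟨C, hC⟩ := (isCompact_sphere (0 : ℂ) 1).exists_bound_of_continuousOn hc.continuousOn
  have hm : Measurable fun y => Complex.exp (θ y * Complex.I) := by fun_prop
  refine Integrable.of_bound (hc.measurable.comp hm).aestronglyMeasurable C (.of_forall fun y => ?_)
  exact hC _ (by simp [Complex.norm_exp_ofReal_mul_I])

omit [IsFiniteMeasure μ] in
lemma polyEnergy_nonneg (p : ℝ[X]) : 0 ≤ polyEnergy μ θ p :=
  integral_nonneg fun _ => by positivity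

lemma polyEnergy_le_of_norm_le (hθ : Measurable θ) (hcos : ∀ᵐ y ∂μ, cos (θ y) ≤ 0) {p q : ℝ[X]}
    {C : ℝ} (h : ∀ w : ℂ, ‖w‖ = 1 → w.re ≤ 0 → ‖aeval w p‖ ^ 2 ≤ C * ‖aeval w q‖ ^ 2) :
    polyEnergy μ θ p ≤ C * polyEnergy μ θ q := by
  rw [polyEnergy, polyEnergy, ← integral_const_mul]
  refine integral_mono_ae (integrable_norm_aeval_sq hθ p)
    ((integrable_norm_aeval_sq hθ q).const_mul C) ?_
  filter_upwards [hcos] with y hy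
  exact h _ (Complex.norm_exp_ofReal_mul_I _) (by rwa [Complex.exp_ofReal_mul_I_re])

omit [IsFiniteMeasure μ] in
lemma polyEnergy_X_pow_mul (m : ℕ) (p : ℝ[X]) :
    polyEnergy μ θ (X ^ m * p) = polyEnergy μ θ p := by
  simp [polyEnergy, Complex.norm_exp_ofReal_mul_I]

end PolyEnergy

section Spectral

variable {Ω : Type*} [MeasurableSpace Ω] {P : Measure Ω} {X : ℕ → Ω → ℝ}
  {μ : Measure ℝ} [IsFiniteMeasure μ] {θ : ℝ → ℝ}

lemma norm_sum_mul_exp_sq (s : Finset ℕ) (b : ℕ → ℝ) (t : ℝ) :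
    ‖∑ k ∈ s, (b k : ℂ) * Complex.exp (t * Complex.I) ^ k‖ ^ 2 =
      ∑ j ∈ s, ∑ k ∈ s, b j * b k * cos ((j - k : ℝ) * t) := by
  have h : ∀ k : ℕ, Complex.exp (t * Complex.I) ^ k = Complex.exp ((k * t : ℝ) * Complex.I) := by
    intro k
    rw [← Complex.exp_nat_mul]
    congr 1
    push_cast; ring
  rw [Complex.sq_norm, Complex.normSq_apply, Complex.re_sum, Complex.im_sum]
  simp only [h, Complex.re_ofReal_mul, Complex.im_ofReal_mul, Complex.exp_ofReal_mul_I_re,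
    Complex.exp_ofReal_mul_I_im, Finset.sum_mul_sum, ← Finset.sum_add_distrib]
  refine Finset.sum_congr rfl fun j _ => Finset.sum_congr rfl fun k _ => ?_
  rw [sub_mul, Real.cos_sub]
  ring

lemma integral_sum_sq_eq (hX : ∀ i, MemLp (X i) 2 P) (hθ : Measurable θ)
    (hcov : ∀ j k : ℕ, ∫ ω, X j ω * X k ω ∂P = ∫ y, cos ((j - k : ℝ) * θ y) ∂μ)
    (s : Finset ℕ) (b : ℕ → ℝ) :
    ∫ ω, (∑ k ∈ s, b k * X k ω) ^ 2 ∂P =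
      ∫ y, ‖∑ k ∈ s, (b k : ℂ) * Complex.exp (θ y * Complex.I) ^ k‖ ^ 2 ∂μ := by
  have h1 : ∀ ω, (∑ k ∈ s, b k * X k ω) ^ 2 =
      ∑ j ∈ s, ∑ k ∈ s, b j * b k * (X j ω * X k ω) := by
    intro ω
    rw [sq, Finset.sum_mul_sum]
    exact Finset.sum_congr rfl fun j _ => Finset.sum_congr rfl fun k _ => by ring
  have hi1 : ∀ j k, Integrable (fun ω => b j * b k * (X j ω * X k ω)) P :=
    fun j k => ((hX j).integrable_mul (hX k)).const_mul _
  have hi2 : ∀ j k : ℕ, Integrable (fun y => b j * b k * cos ((j - k : ℝ) * θ y)) μ := by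
    intro j k
    refine Integrable.const_mul (Integrable.of_bound (C := 1) ?_ (.of_forall fun y => ?_)) _
    · exact (by fun_prop : Measurable fun y => cos ((j - k : ℝ) * θ y)).aestronglyMeasurable
    · exact Real.abs_cos_le_one _
  simp_rw [h1, norm_sum_mul_exp_sq]
  rw [integral_finsetSum _ fun j _ => integrable_finsetSum _ fun k _ => hi1 j k,
    integral_finsetSum _ fun j _ => integrable_finsetSum _ fun k _ => hi2 j k]
  refine Finset.sum_congr rfl fun j _ => ?_
  rw [integral_finsetSum _ fun k _ => hi1 j k, integral_finsetSum _ fun k _ => hi2 j k]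
  refine Finset.sum_congr rfl fun k _ => ?_
  rw [integral_const_mul, integral_const_mul, hcov]

lemma integral_sum_coeff_sq_eq (hX : ∀ i, MemLp (X i) 2 P) (hθ : Measurable θ)
    (hcov : ∀ j k : ℕ, ∫ ω, X j ω * X k ω ∂P = ∫ y, cos ((j - k : ℝ) * θ y) ∂μ)
    (p : Polynomial ℝ) {n : ℕ} (hn : p.natDegree < n) :
    ∫ ω, (∑ k ∈ Finset.range n, p.coeff k * X k ω) ^ 2 ∂P = polyEnergy μ θ p := by
  rw [integral_sum_sq_eq hX hθ hcov, polyEnergy]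
  simp only [Polynomial.aeval_eq_sum_range' hn, Complex.real_smul]

open Polynomial in
/-- The residual of `X n` against earlier terms has the energy of a monic polynomial. -/
lemma exists_monic_integral_sub_sum_sq_eq (hX : ∀ i, MemLp (X i) 2 P) (hθ : Measurable θ)
    (hcov : ∀ j k : ℕ, ∫ ω, X j ω * X k ω ∂P = ∫ y, cos ((j - k : ℝ) * θ y) ∂μ)
    (n : ℕ) (c : ℕ → ℝ) :
    ∃ p : ℝ[X], p.Monic ∧ p.natDegree = n ∧
      ∫ ω, (X n ω - ∑ i ∈ Finset.range n, c i * X i ω) ^ 2 ∂P = polyEnergy μ θ p := by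
  let r : ℝ[X] := ∑ i ∈ Finset.range n, C (- c i) * Polynomial.X ^ i
  have hcr : ∀ k, r.coeff k = if k < n then - c k else 0 := by
    intro k
    simp only [r, finsetSum_coeff, coeff_C_mul, coeff_X_pow, mul_ite, mul_one, mul_zero,
      Finset.sum_ite_eq, Finset.mem_range]
  have hr : r.degree < n := by
    rw [degree_lt_iff_coeff_zero]
    intro k hk
    rw [hcr, if_neg hk.not_gt]
  have hd : (Polynomial.X ^ n + r).natDegree = n := natDegree_X_pow_add_of_degree_lt hr
  refine ⟨Polynomial.X ^ n + r, monic_X_pow_add hr, hd, ?_⟩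
  rw [← integral_sum_coeff_sq_eq hX hθ hcov _ (n := n + 1) (by lia)]
  refine integral_congr_ae (.of_forall fun ω => ?_)
  simp only [Finset.sum_range_succ, coeff_add, coeff_X_pow, hcr, lt_irrefl, if_true, if_false]
  have : ∑ k ∈ Finset.range n, ((if k = n then (1 : ℝ) else 0) + if k < n then -c k else 0) * X k ω
      = - ∑ k ∈ Finset.range n, c k * X k ω := by
    rw [← Finset.sum_neg_distrib]
    refine Finset.sum_congr rfl fun k hk => ?_
    have := Finset.mem_range.1 hk
    rw [if_neg this.ne, if_pos this]; ring
  rw [this]; ring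

open Polynomial in
lemma exists_monic_polyEnergy_le (hX : ∀ i, MemLp (X i) 2 P) (hθ : Measurable θ)
    (hcov : ∀ j k : ℕ, ∫ ω, X j ω * X k ω ∂P = ∫ y, cos ((j - k : ℝ) * θ y) ∂μ) (n : ℕ) :
    ∃ q : ℝ[X], q.Monic ∧ q.natDegree = n ∧
      ∀ p : ℝ[X], p.Monic → p.natDegree = n → polyEnergy μ θ q ≤ polyEnergy μ θ p := by
  obtain ⟨c, hc⟩ := exists_proj_of_memLp hX n
  obtain ⟨q, hqm, hqd, hq⟩ := exists_monic_integral_sub_sum_sq_eq hX hθ hcov n c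
  refine ⟨q, hqm, hqd, fun p hpm hpd => ?_⟩
  rw [← hq, ← integral_sum_coeff_sq_eq hX hθ hcov p (n := n + 1) (by lia)]
  refine (integral_sq_le_of_orthogonal hX n hc fun i => - p.coeff i).trans_eq ?_
  refine integral_congr_ae (.of_forall fun ω => ?_)
  have : p.coeff n = 1 := by rw [← hpd]; exact hpm
  simp only [Finset.sum_range_succ, this, neg_mul, Finset.sum_neg_distrib]
  ring

end Spectral

section Core

variable {Ω : Type*} [MeasurableSpace Ω] {P : Measure Ω} [IsProbabilityMeasure P]
  {X : ℕ → Ω → ℝ} {μ : Measure ℝ} [IsFiniteMeasure μ] {θ : ℝ → ℝ}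

open Polynomial in
/-- The weights are the normalized coefficients of `q * (X + 1) ^ N`, where `q` is a monic polynomial
of degree `17 * N` of minimal energy all of whose coefficients are nonnegative. -/
theorem exists_weights_of_cos_nonpos (hX : ∀ i, Measurable (X i)) (hθ : Measurable θ)
    (hμ : μ ≠ 0) (hcos : ∀ᵐ y ∂μ, cos (θ y) ≤ 0)
    (hG : ∀ m, IsCenteredGaussianSeq P fun j => X (m + j))
    (hcov : ∀ j k : ℕ, ∫ ω, X j ω * X k ω ∂P = ∫ y, cos ((j - k : ℝ) * θ y) ∂μ)
    {N n : ℕ} (hn : 18 * N ≤ n) :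
    ∃ (σ : ℝ) (β : ℕ → ℝ), 0 ≤ σ ∧ σ ≤ √(μ.real Set.univ) ∧ (∀ k, 0 ≤ β k) ∧
      ∑ k ∈ Finset.range (n + 1), β k = 1 ∧
      ∫ ω, (∑ k ∈ Finset.range (n + 1), β k * X k ω) ^ 2 ∂P ≤ (1 / 2) ^ N * σ ^ 2 ∧
      ∀ φ : ℕ → ℝ,
        P {ω | (∀ k < n + 1, 0 < β k → 0 ≤ X k ω + φ k) ∧
          ∑ k ∈ Finset.range (n + 1), β k * (X k ω + φ k) ≤ σ} ≤
        ENNReal.ofReal ((1 / 2) ^ N ^ 2) := by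
  have hL : ∀ i, MemLp (X i) 2 P := by
    have := (hG 0).memLp (by simpa using hX)
    simpa using this
  have hcov' : ∀ m j k : ℕ, ∫ ω, X (m + j) ω * X (m + k) ω ∂P =
      ∫ y, cos ((j - k : ℝ) * θ y) ∂μ := by
    intro m j k
    rw [hcov]; push_cast; simp
  obtain ⟨q₀, hq₀m, hq₀d, hq₀⟩ := exists_monic_polyEnergy_le hL hθ hcov (17 * N)
  obtain ⟨q, hqm, hqd, hq0, hqn⟩ := hq₀m.exists_nonneg_coeff_norm_le
  rw [hq₀d] at hqd
  have hqmin : ∀ p : ℝ[X], p.Monic → p.natDegree = 17 * N →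
      polyEnergy μ θ q ≤ polyEnergy μ θ p := by
    intro p hpm hpd
    refine le_trans ?_ (hq₀ p hpm hpd)
    have := polyEnergy_le_of_norm_le (C := 1) hθ hcos (p := q) (q := q₀) fun w hw hw' => by
      rw [one_mul]
      exact pow_le_pow_left₀ (norm_nonneg _) (hqn w hw hw') 2
    simpa using this
  set W := polyEnergy μ θ q with hW
  have hW0 : 0 ≤ W := polyEnergy_nonneg q
  set s := q.eval 1 with hs
  have hs1 : 1 ≤ s := by
    rw [hs, eval_eq_sum_range, Finset.sum_range_succ, hqm.coeff_natDegree]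
    have := Finset.sum_nonneg (s := Finset.range q.natDegree) fun k _ => hq0 k
    simpa using this
  have hone : polyEnergy μ θ (1 : ℝ[X]) = μ.real Set.univ := by simp [polyEnergy]
  have hWμ : W ≤ μ.real Set.univ := by
    rw [← hone, ← polyEnergy_X_pow_mul (17 * N), mul_one]
    exact hqmin _ (monic_X_pow _) (natDegree_X_pow _)
  have hμ0 : 0 < μ.real Set.univ := by
    rw [measureReal_def]
    exact ENNReal.toReal_pos (by simpa using hμ) (measure_ne_top _ _)
  set B : ℝ[X] := (Polynomial.X + C 1) ^ N with hB
  have hBcoeff : ∀ k, B.coeff k = N.choose k := by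
    intro k; rw [hB, map_one, coeff_X_add_one_pow]
  have hBm : B.Monic := (monic_X_add_C 1).pow N
  have hBd : B.natDegree = N := by
    rw [hB, (monic_X_add_C 1).natDegree_pow, natDegree_X_add_C, mul_one]
  have hRd : (q * B).natDegree = 18 * N := by rw [hqm.natDegree_mul hBm, hqd, hBd]; ring
  have hRe : (q * B).eval 1 = s * 2 ^ N := by
    rw [eval_mul, hB, eval_pow]; simp only [eval_add, eval_X, eval_C]; norm_num [hs]
  have hR0 : ∀ k, 0 ≤ (q * B).coeff k := fun k => by
    rw [coeff_mul]
    exact Finset.sum_nonneg fun x _ => mul_nonneg (hq0 _) (by rw [hBcoeff]; positivity)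
  have hRlow : ∀ j ≤ N, 1 ≤ (q * B).coeff (17 * N + j) := by
    intro j hj
    rw [coeff_mul]
    refine le_trans ?_ (Finset.single_le_sum (fun x _ => mul_nonneg (hq0 _)
      (by rw [hBcoeff]; positivity)) (Finset.HasAntidiagonal.mem_antidiagonal.2
        (rfl : (17 * N, j).1 + (17 * N, j).2 = 17 * N + j)))
    rw [hBcoeff, ← hqd, hqm.coeff_natDegree, one_mul]
    exact_mod_cast Nat.choose_pos hj
  have hsN : 0 < s * 2 ^ N := by positivity
  have hER : polyEnergy μ θ (q * B) ≤ 2 ^ N * W := by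
    refine polyEnergy_le_of_norm_le hθ hcos fun w hw hw' => ?_
    rw [map_mul, norm_mul, mul_pow, mul_comm]
    gcongr
    rw [hB, map_pow, norm_pow, ← pow_mul, mul_comm N 2, pow_mul]
    refine pow_le_pow_left₀ (by positivity) ?_ _
    simpa using normSq_add_one_le hw hw'
  -- lower bound for the prediction errors of the shifted sequences
  have hpred : ∀ j ≤ N, ∀ c : ℕ → ℝ, 16 ^ N * W ≤
      ∫ ω, (X (17 * N + j) ω - ∑ i ∈ Finset.range j, c i * X (17 * N + i) ω) ^ 2 ∂P := by
    intro j hj c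
    obtain ⟨p, hpm, hpd, hp⟩ := exists_monic_integral_sub_sum_sq_eq
      (X := fun i => X (17 * N + i)) (fun i => hL _) hθ (hcov' (17 * N)) j c
    rw [hp]
    set g : ℝ[X] := Polynomial.X ^ 2 + (C (2 / 3) * Polynomial.X + C (1 / 2)) with hg
    have hgdeg : (C (2 / 3) * Polynomial.X + C (1 / 2) : ℝ[X]).degree < ((2 : ℕ) : WithBot ℕ) :=
      degree_linear_lt
    have hgm : g.Monic := monic_X_pow_add hgdeg
    have hgd : g.natDegree = 2 := natDegree_X_pow_add_of_degree_lt hgdeg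
    have h1 := hqmin (Polynomial.X ^ (N - j) * (g ^ (8 * N) * p))
      ((monic_X_pow _).mul ((hgm.pow _).mul hpm)) (by
        rw [(monic_X_pow _).natDegree_mul ((hgm.pow _).mul hpm), (hgm.pow _).natDegree_mul hpm,
          hgm.natDegree_pow, hgd, hpd, natDegree_X_pow]
        lia)
    rw [polyEnergy_X_pow_mul] at h1
    have h2 : polyEnergy μ θ (g ^ (8 * N) * p) ≤ (1 / 16) ^ N * polyEnergy μ θ p := by
      refine polyEnergy_le_of_norm_le hθ hcos fun w hw hw' => ?_
      rw [map_mul, norm_mul, mul_pow]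
      gcongr
      rw [map_pow, norm_pow, ← pow_mul, mul_comm _ 2, pow_mul, pow_mul]
      refine pow_le_pow_left₀ (by positivity) ?_ _
      have h3 : ‖aeval w g‖ ^ 2 ≤ 25 / 36 := by
        have := normSq_quadratic_le hw hw'
        rw [hg]
        simpa using this
      calc (‖aeval w g‖ ^ 2) ^ 8 ≤ (25 / 36) ^ 8 := pow_le_pow_left₀ (by positivity) h3 8
        _ ≤ 1 / 16 := by norm_num
    have h4 : W ≤ (1 / 16) ^ N * polyEnergy μ θ p := h1.trans h2
    calc 16 ^ N * W ≤ 16 ^ N * ((1 / 16) ^ N * polyEnergy μ θ p) := by gcongr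
      _ = polyEnergy μ θ p := by rw [← mul_assoc, ← mul_pow]; norm_num
  refine ⟨√W / s, fun k => (q * B).coeff k / (s * 2 ^ N), by positivity, ?_,
    fun k => div_nonneg (hR0 k) hsN.le, ?_, ?_, fun φ => ?_⟩
  · calc √W / s ≤ √W := div_le_self (Real.sqrt_nonneg _) hs1
      _ ≤ _ := Real.sqrt_le_sqrt hWμ
  · rw [← Finset.sum_div, ← hRe, eval_eq_sum_range' (n := n + 1) (by lia)]
    simp only [one_pow, mul_one]
    refine div_self ?_
    have : ∑ k ∈ Finset.range (n + 1), (q * B).coeff k = (q * B).eval 1 := by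
      rw [eval_eq_sum_range' (n := n + 1) (by lia)]; simp
    rw [this, hRe]; exact hsN.ne'
  · have h1 : ∀ ω, (∑ k ∈ Finset.range (n + 1), (q * B).coeff k / (s * 2 ^ N) * X k ω) ^ 2 =
        (s * 2 ^ N)⁻¹ ^ 2 * (∑ k ∈ Finset.range (n + 1), (q * B).coeff k * X k ω) ^ 2 := by
      intro ω
      rw [← mul_pow, Finset.mul_sum]
      congr 1
      exact Finset.sum_congr rfl fun k _ => by ring
    simp_rw [h1]
    rw [integral_const_mul, integral_sum_coeff_sq_eq hL hθ hcov _ (by lia)]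
    calc _ ≤ (s * 2 ^ N)⁻¹ ^ 2 * (2 ^ N * W) := by gcongr
      _ = (1 / 2) ^ N * (√W / s) ^ 2 := by
        rw [div_pow √W, Real.sq_sqrt hW0]
        field_simp
        rw [mul_right_comm, ← mul_pow]
        norm_num
  · set ℓ := 2 ^ N * √W with hℓ
    have hsub : ∀ j ≤ N, ∀ ω, ((∀ k < n + 1, 0 < (q * B).coeff k / (s * 2 ^ N) →
          0 ≤ X k ω + φ k) ∧
        ∑ k ∈ Finset.range (n + 1), (q * B).coeff k / (s * 2 ^ N) * (X k ω + φ k) ≤ √W / s) →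
        X (17 * N + j) ω ∈ Set.Icc (- φ (17 * N + j)) (- φ (17 * N + j) + ℓ) := by
      rintro j hj ω ⟨hpos, hsum⟩
      have hbj : 0 < (q * B).coeff (17 * N + j) / (s * 2 ^ N) :=
        div_pos (by linarith [hRlow j hj]) hsN
      have hx := hpos (17 * N + j) (by lia) hbj
      have hle : (q * B).coeff (17 * N + j) / (s * 2 ^ N) *
          (X (17 * N + j) ω + φ (17 * N + j)) ≤ √W / s := by
        refine le_trans (Finset.single_le_sum (f := fun k => (q * B).coeff k / (s * 2 ^ N) *
          (X k ω + φ k)) (fun k hk => ?_) (Finset.mem_range.2 (by lia))) hsum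
        rcases (div_nonneg (hR0 k) hsN.le).eq_or_lt with h | h
        · simp only [← h, zero_mul, le_refl]
        · exact mul_nonneg h.le (hpos k (Finset.mem_range.1 hk) h)
      have h2 : (s * 2 ^ N)⁻¹ * (X (17 * N + j) ω + φ (17 * N + j)) ≤ √W / s := by
        refine le_trans ?_ hle
        gcongr
        rw [inv_eq_one_div]
        gcongr
        exact hRlow j hj
      have h3 : X (17 * N + j) ω + φ (17 * N + j) ≤ ℓ := by
        rw [inv_mul_le_iff₀ hsN] at h2
        refine h2.trans_eq ?_
        rw [hℓ]; field_simp
      constructor <;> linarith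
    rcases hW0.eq_or_lt with hW00 | hWpos
    · have hℓ0 : ℓ = 0 := by rw [hℓ, ← hW00]; simp
      have key := (hG (17 * N)).measure_forall_mem_Icc_le (fun i => hX _)
        (fun _ => μ.real Set.univ) (fun j => - φ (17 * N + j)) (fun _ => ℓ) 1 (fun _ _ => hμ0)
        (fun _ _ => hℓ0.ge) (fun j hj c => by
          obtain rfl : j = 0 := by lia
          have := hcov' (17 * N) 0 0
          simp only [sub_self, zero_mul, cos_zero, integral_const, smul_eq_mul, mul_one] at this
          simp [← this, sq])
      refine (measure_mono fun ω hω => ?_).trans (key.trans ?_)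
      · exact fun j hj => hsub j (by lia) ω hω
      · simp [hℓ0]
    · have key := (hG (17 * N)).measure_forall_mem_Icc_le (fun i => hX _)
        (fun _ => 16 ^ N * W) (fun j => - φ (17 * N + j)) (fun _ => ℓ) (N + 1)
        (fun _ _ => by positivity) (fun _ _ => by positivity)
        (fun j hj c => hpred j (by lia) c)
      refine (measure_mono fun ω hω => ?_).trans (key.trans ?_)
      · exact fun j hj => hsub j (by lia) ω hω
      · refine ENNReal.ofReal_le_ofReal ?_
        have h16 : √((16 : ℝ) ^ N * W) = 4 ^ N * √W := by
          rw [Real.sqrt_mul (by positivity)]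
          congr 1
          rw [show (16 : ℝ) ^ N = (4 ^ N) ^ 2 by rw [← pow_mul, mul_comm, pow_mul]; norm_num]
          exact Real.sqrt_sq (by positivity)
        have hr : ℓ / √((16 : ℝ) ^ N * W) = (1 / 2) ^ N := by
          have hWs : 0 < √W := Real.sqrt_pos.2 hWpos
          rw [h16, hℓ, mul_div_mul_right _ _ hWs.ne', ← div_pow]
          norm_num
        rw [Finset.prod_const, Finset.card_range, hr, ← pow_mul]
        exact pow_le_pow_of_le_one (by norm_num) (by norm_num) (by nlinarith)

end Core

lemma one_half_pow_eq_exp (k : ℕ) : (1 / 2 : ℝ) ^ k = Real.exp (-(Real.log 2 * k)) := by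
  rw [← neg_mul, mul_comm, Real.exp_nat_mul, Real.exp_neg, Real.exp_log (by norm_num)]
  norm_num

/-- **Main Lemma, scaled version.** There exist `n₀ ∈ ℕ` and `c, c' > 0`,
independent of the scaling parameter `a > 0`, such that if `f` is a centered continuous
stationary Gaussian process on `ℝ` whose spectral measure `μ` is supported on
`[-a/2, a/2] \ (-a/4, a/4)`, then for every `n ≥ n₀` there are `σ ∈ [0, √μ(ℝ)]` and
nonnegative weights `β₀, …, β_n` summing to `1` with
`E[(∑ β_k f(k/a))²] ≤ e^{-6cn} σ²` and, for every deterministic `φ : ℝ → ℝ`,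
`P{f + φ ≥ 0 on {k/a : β_k > 0}, ∑ β_k (f(k/a) + φ(k/a)) ≤ e^{-cn} σ} ≤ e^{-c'n²}`. -/
theorem main_lemma_spectral_annulus_scaled :
    ∃ (n₀ : ℕ) (c c' : ℝ), 0 < c ∧ 0 < c' ∧
      ∀ (a : ℝ), 0 < a →
      ∀ (Ω : Type) (_ : MeasurableSpace Ω) (P : Measure Ω), IsProbabilityMeasure P →
      ∀ (μ : Measure ℝ), IsFiniteMeasure μ → μ ≠ 0 →
      (∀ E : Set ℝ, MeasurableSet E → μ ((fun x : ℝ => -x) ⁻¹' E) = μ E) →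
      μ (Set.Icc (-(a/2)) (a/2) \ Set.Ioo (-(a/4)) (a/4))ᶜ = 0 →
      ∀ (f : ℝ → Ω → ℝ),
      Measurable (fun p : ℝ × Ω => f p.1 p.2) →
      (∀ (m : ℕ) (x : Fin m → ℝ) (b : Fin m → ℝ), ∃ v : ℝ≥0,
        P.map (fun ω => ∑ i, b i * f (x i) ω) = gaussianReal 0 v) →
      (∀ᵐ ω ∂P, Continuous fun x => f x ω) →
      (∀ s t : ℝ, ∫ ω, f s ω * f t ω ∂P = ∫ y, Real.cos (2 * π * (s - t) * y) ∂μ) →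
      ∀ n : ℕ, n₀ ≤ n →
        ∃ (σ : ℝ) (β : Fin (n + 1) → ℝ),
          σ ∈ Set.Icc 0 (Real.sqrt (μ Set.univ).toReal) ∧
          (∀ k, 0 ≤ β k) ∧ (∑ k, β k) = 1 ∧
          (∫ ω, (∑ k, β k * f ((k : ℕ) / a) ω) ^ 2 ∂P ≤ Real.exp (-6 * c * n) * σ ^ 2) ∧
          (∀ φ : ℝ → ℝ,
            P {ω | (∀ k : Fin (n + 1), 0 < β k → 0 ≤ f ((k : ℕ) / a) ω + φ ((k : ℕ) / a)) ∧
                ∑ k, β k * (f ((k : ℕ) / a) ω + φ ((k : ℕ) / a)) ≤ Real.exp (-c * n) * σ} ≤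
              ENNReal.ofReal (Real.exp (-c' * (n : ℝ) ^ 2))) := by
  refine ⟨18, 1 / 500, 1 / 2000, by norm_num, by norm_num, ?_⟩
  intro a ha Ω _ P _ μ _ hμ _ hsupp f hf hG _ hcov n hn
  let X : ℕ → Ω → ℝ := fun k => f (k / a)
  let θ : ℝ → ℝ := fun y => 2 * π * (y / a)
  have hX : ∀ i, Measurable (X i) := fun i => hf.comp measurable_prodMk_left
  have hθ : Measurable θ := by fun_prop
  have hcos : ∀ᵐ y ∂μ, cos (θ y) ≤ 0 := by
    filter_upwards [mem_ae_iff.2 hsupp] with y hy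
    obtain ⟨⟨h1, h2⟩, h3⟩ := hy
    have hpos : ∀ t : ℝ, a / 4 ≤ t → t ≤ a / 2 → cos (2 * π * (t / a)) ≤ 0 := by
      intro t ht ht'
      have e1 : 1 / 4 ≤ t / a := by rw [le_div_iff₀ ha]; linarith
      have e2 : t / a ≤ 1 / 2 := by rw [div_le_iff₀ ha]; linarith
      exact Real.cos_nonpos_of_pi_div_two_le_of_le (by nlinarith [Real.pi_pos])
        (by nlinarith [Real.pi_pos])
    by_cases hy4 : a / 4 ≤ y
    · exact hpos y hy4 h2
    · have hy' : y ≤ -(a / 4) := by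
        by_contra! hc
        exact h3 ⟨hc, not_le.1 hy4⟩
      have := hpos (-y) (by linarith) (by linarith)
      rwa [neg_div, mul_neg, Real.cos_neg] at this
  have hGX : ∀ m, IsCenteredGaussianSeq P fun j => X (m + j) := fun m k b =>
    hG k (fun i => ((m + i : ℕ) : ℝ) / a) b
  have hcovX : ∀ j k : ℕ, ∫ ω, X j ω * X k ω ∂P = ∫ y, cos ((j - k : ℝ) * θ y) ∂μ := by
    intro j k
    rw [hcov]
    refine integral_congr_ae (.of_forall fun y => ?_)
    simp only [θ]
    congr 1
    field_simp
  set N := n / 18 with hN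
  have hN1 : 1 ≤ N := by lia
  have hnN : (n : ℝ) ≤ 35 * N := by
    have : n ≤ 35 * N := by lia
    exact_mod_cast this
  have hlog := Real.log_two_gt_d9
  have hN1' : (1 : ℝ) ≤ N := by exact_mod_cast hN1
  obtain ⟨σ, β, hσ0, hσ, hβ0, hβ1, hvar, hprob⟩ :=
    exists_weights_of_cos_nonpos hX hθ hμ hcos hGX hcovX (N := N) (n := n) (by lia)
  refine ⟨σ, fun k => β k, ⟨hσ0, hσ⟩, fun k => hβ0 k, ?_, ?_, fun φ => ?_⟩
  · rw [← hβ1, Finset.sum_range]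
  · simp only [Finset.sum_range] at hvar
    refine hvar.trans ?_
    rw [one_half_pow_eq_exp]
    gcongr
    nlinarith
  · refine (measure_mono fun ω hω => ?_).trans ((hprob fun k => φ (k / a)).trans ?_)
    · obtain ⟨h1, h2⟩ := hω
      refine ⟨fun k hk hk0 => h1 ⟨k, hk⟩ hk0, ?_⟩
      rw [Finset.sum_range]
      refine h2.trans (mul_le_of_le_one_left hσ0 ?_)
      rw [Real.exp_le_one_iff]
      have : (0 : ℝ) ≤ n := Nat.cast_nonneg n
      linarith
    · refine ENNReal.ofReal_le_ofReal ?_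
      rw [one_half_pow_eq_exp]
      gcongr
      push_cast
      have : (n : ℝ) ^ 2 ≤ (35 * N) ^ 2 := by gcongr
      nlinarith [sq_nonneg (N : ℝ)]
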